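/- arXiv:2601.12011 — 10 statements merged into one kernel-verified Lean document; each statement's English description precedes it below -/
import Mathlib

section
/- The explicit spectral factorization of the SEL matrix is exact: with Σ = diag(√R·1_{k/2−1}, √((R+1)/2), 1_{k/2−1}) ∈ ℝ^{(k−1)×(k−1)}, U = [[F, −√(1/k)·1_{k/2}, 0],[0, √(1/k)·1_{k/2}, F]] ∈ ℝ^{k×(k−1)}, and V^T ∈ ℝ^{(k−1)×n} whose block rows are [√(1/R)·(F^T ⊗ 1_R^T), 0], [−√(2/((R+1)k))·1_{Rk/2}^T, √(2/((R+1)k))·1_{k/2}^T], and [0, F^T], one has Z = U Σ V^T. -/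
open Matrix Real

noncomputable section

/-- Index type for the `k = 2m` classes: `inl` = majorities, `inr` = minorities. -/
abbrev ClassIdx (m : ℕ) := Fin m ⊕ Fin m

/-- Index type for the `n = (R+1)m` samples: each majority class has `R` samples,
each minority class has `1` sample. -/
abbrev SampleIdx (m R : ℕ) := (Fin m × Fin R) ⊕ Fin m

/-- Index type for the `k - 1 = 2m - 1` spectral modes: maj-maj, maj-min, min-min. -/
abbrev SpecIdx (m : ℕ) := Fin (m - 1) ⊕ (Unit ⊕ Fin (m - 1))

/-- One-hot label matrix `Y = [[I_{k/2} ⊗ 1_R^T, 0], [0, I_{k/2}]]`. -/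
def Ymat (m R : ℕ) : Matrix (ClassIdx m) (SampleIdx m R) ℝ :=
  Matrix.of fun c s =>
    match c, s with
    | Sum.inl c, Sum.inl (c', _) => if c = c' then 1 else 0
    | Sum.inl _, Sum.inr _ => 0
    | Sum.inr _, Sum.inl _ => 0
    | Sum.inr c, Sum.inr c' => if c = c' then 1 else 0

/-- Simplex-encoded label (SEL) matrix `Z = (I_k − (1/k) 1_k 1_k^T) Y`, `k = 2m`. -/
def Zmat (m R : ℕ) : Matrix (ClassIdx m) (SampleIdx m R) ℝ :=
  ((1 : Matrix (ClassIdx m) (ClassIdx m) ℝ)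
      - (2 * (m : ℝ))⁻¹ • Matrix.of fun _ _ => (1 : ℝ)) * Ymat m R

/-- Left singular vectors `U = [[F, −√(1/k)·1, 0], [0, √(1/k)·1, F]]`, `k = 2m`. -/
def Umat (m : ℕ) (F : Matrix (Fin m) (Fin (m - 1)) ℝ) :
    Matrix (ClassIdx m) (SpecIdx m) ℝ :=
  Matrix.of fun c j =>
    match c, j with
    | Sum.inl i, Sum.inl j => F i j
    | Sum.inl _, Sum.inr (Sum.inl _) => -Real.sqrt (1 / (2 * (m : ℝ)))
    | Sum.inl _, Sum.inr (Sum.inr _) => 0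
    | Sum.inr _, Sum.inl _ => 0
    | Sum.inr _, Sum.inr (Sum.inl _) => Real.sqrt (1 / (2 * (m : ℝ)))
    | Sum.inr i, Sum.inr (Sum.inr j) => F i j

/-- Singular values: `√R` (maj-maj), `√((R+1)/2)` (maj-min), `1` (min-min). -/
def sigv (m R : ℕ) : SpecIdx m → ℝ :=
  fun j =>
    match j with
    | Sum.inl _ => Real.sqrt (R : ℝ)
    | Sum.inr (Sum.inl _) => Real.sqrt (((R : ℝ) + 1) / 2)
    | Sum.inr (Sum.inr _) => 1

/-- `Σ = diag(√R·1_{k/2−1}, √((R+1)/2), 1_{k/2−1})`. -/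
def Sigmat (m R : ℕ) : Matrix (SpecIdx m) (SpecIdx m) ℝ :=
  Matrix.diagonal (sigv m R)

/-- Transposed right singular vectors `V^T` with block rows
`[√(1/R)·(F^T ⊗ 1_R^T), 0]`, `[−√(2/((R+1)k))·1^T, √(2/((R+1)k))·1^T]`, `[0, F^T]`. -/
def Vtmat (m R : ℕ) (F : Matrix (Fin m) (Fin (m - 1)) ℝ) :
    Matrix (SpecIdx m) (SampleIdx m R) ℝ :=
  Matrix.of fun j s =>
    match j, s with
    | Sum.inl j, Sum.inl (c, _) => Real.sqrt (1 / (R : ℝ)) * F c j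
    | Sum.inl _, Sum.inr _ => 0
    | Sum.inr (Sum.inl _), Sum.inl _ => -Real.sqrt (2 / (((R : ℝ) + 1) * (2 * (m : ℝ))))
    | Sum.inr (Sum.inl _), Sum.inr _ => Real.sqrt (2 / (((R : ℝ) + 1) * (2 * (m : ℝ))))
    | Sum.inr (Sum.inr _), Sum.inl _ => 0
    | Sum.inr (Sum.inr j), Sum.inr c => F c j

/-- Reweighting matrix `Ω = √(R+1)·diag(√(1/R)·1_{Rk/2}^T, 1_{k/2}^T)`. -/
def Omegamat (m R : ℕ) : Matrix (SampleIdx m R) (SampleIdx m R) ℝ :=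
  Matrix.diagonal fun s =>
    match s with
    | Sum.inl _ => Real.sqrt ((R : ℝ) + 1) * Real.sqrt (1 / (R : ℝ))
    | Sum.inr _ => Real.sqrt ((R : ℝ) + 1)

/-- Effective weights `λ_i`. -/
def lamv (m R : ℕ) : SpecIdx m → ℝ :=
  fun j =>
    match j with
    | Sum.inl _ => Real.sqrt (((R : ℝ) + 1) / (R : ℝ))
    | Sum.inr (Sum.inl _) => (Real.sqrt (R : ℝ) + 1) / Real.sqrt ((R : ℝ) + 1)
    | Sum.inr (Sum.inr _) => Real.sqrt ((R : ℝ) + 1)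

/-- Effective weight matrix `Λ`. -/
def Lammat (m R : ℕ) : Matrix (SpecIdx m) (SpecIdx m) ℝ :=
  Matrix.diagonal (lamv m R)

/-- A matrix whose orthonormal columns span the orthogonal complement of the all-ones vector
satisfies `F Fᵀ = 1 - (1/m) J`, where `J` is the all-ones matrix of size `m`. -/
theorem mul_transpose_of_orthonormal_of_sum_eq_zero {m : ℕ} (hm : m ≠ 0)
    (F : Matrix (Fin m) (Fin (m - 1)) ℝ)
    (hF_orth : Fᵀ * F = 1) (hF_ones : ∀ j, ∑ i, F i j = 0) (a b : Fin m) :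
    ∑ j, F a j * F b j = (if a = b then 1 else 0) - (m : ℝ)⁻¹ := by
  have hm' : (m : ℝ) ≠ 0 := Nat.cast_ne_zero.mpr hm
  let A : Matrix (Fin m) (Fin (m - 1) ⊕ Unit) ℝ := fromCols F (of fun _ _ => 1)
  let B : Matrix (Fin (m - 1) ⊕ Unit) (Fin m) ℝ := fromRows Fᵀ (of fun _ _ => (m : ℝ)⁻¹)
  have hBA : B * A = 1 := by
    simp only [A, B, fromRows_mul_fromCols, hF_orth, ← fromBlocks_one]
    congr 1 <;> ext i j
    · simp [mul_apply, hF_ones]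
    · simp [mul_apply, ← Finset.mul_sum, hF_ones]
    · simp [mul_apply, hm']
  have hcard : Fintype.card (Fin (m - 1) ⊕ Unit) = Fintype.card (Fin m) := by
    simp; omega
  have hAB : A * B = 1 := (mul_eq_one_comm_of_card_eq _ _ _ hcard).mp hBA
  have h := congrFun (congrFun hAB a) b
  simp only [A, B, mul_apply, one_apply, Fintype.sum_sum_type, fromCols_apply_inl,
    fromCols_apply_inr, fromRows_apply_inl, fromRows_apply_inr, transpose_apply, of_apply,
    Finset.univ_unique, Finset.sum_singleton, one_mul] at h
  linarith

/-- The explicit spectral factorization of the SEL matrix is exact: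
`Z = U Σ V^T` in the `R`-STEP-imbalanced setting with `k = 2m` classes. -/
theorem sel_matrix_spectral_factorization (m R : ℕ) (hm : 2 ≤ m) (hR : 1 ≤ R)
    (F : Matrix (Fin m) (Fin (m - 1)) ℝ)
    (hF_orth : Fᵀ * F = 1) (hF_ones : ∀ j, ∑ i, F i j = 0) :
    Zmat m R = Umat m F * Sigmat m R * Vtmat m R F := by
  have hm0 : (0 : ℝ) < m := by exact_mod_cast (by omega : 0 < m)
  have hR0 : (0 : ℝ) < R := by exact_mod_cast hR
  have hFF := mul_transpose_of_orthonormal_of_sum_eq_zero (by omega) F hF_orth hF_ones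
  have hsqrtR : √(R : ℝ) * √(1 / (R : ℝ)) = 1 := by
    rw [← sqrt_mul hR0.le, mul_one_div_cancel hR0.ne', sqrt_one]
  have hmid : √(1 / (2 * (m : ℝ))) * √(((R : ℝ) + 1) / 2)
      * √(2 / (((R : ℝ) + 1) * (2 * (m : ℝ)))) = (2 * (m : ℝ))⁻¹ := by
    rw [← sqrt_mul (by positivity), ← sqrt_mul (by positivity),
      sqrt_eq_iff_mul_self_eq (by positivity) (by positivity)]
    field_simp
  have hhalf : (m : ℝ)⁻¹ = 2 * (2 * (m : ℝ))⁻¹ := by field_simp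
  have hmaj (a b : Fin m) : ∑ j, F a j * √(R : ℝ) * (√(1 / (R : ℝ)) * F b j)
      = (if a = b then 1 else 0) - (m : ℝ)⁻¹ := by
    rw [← hFF]
    refine Finset.sum_congr rfl fun j _ => ?_
    linear_combination F a j * F b j * hsqrtR
  ext c s
  rw [Zmat, Sigmat, mul_apply, mul_apply]
  simp only [mul_diagonal]
  rcases c with a | a <;> rcases s with ⟨b, r⟩ | b <;>
    simp only [Fintype.sum_sum_type, Finset.univ_unique, Finset.sum_singleton, Umat, Vtmat, sigv,
      Ymat, of_apply, Matrix.sub_apply, Matrix.smul_apply, one_apply, smul_eq_mul, mul_one, mul_ite, mul_zero,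
      zero_mul, Finset.sum_const_zero, Finset.sum_ite_eq', Finset.mem_univ, if_true, hmaj, hFF,
      Sum.inl.injEq, Sum.inr.injEq, reduceCtorEq, if_false, add_zero, zero_add] <;>
    linarith

end
end

section
/- The matrix V ∈ ℝ^{n×(k−1)}, whose transpose V^T has block rows [√(1/R)·(F^T ⊗ 1_R^T), 0], [−√(2/((R+1)k))·1_{Rk/2}^T, √(2/((R+1)k))·1_{k/2}^T], and [0, F^T], has orthonormal columns: V^T V = I_{k−1}. -/
open Matrix Real

noncomputable section

/-- Entrywise form of `Fᵀ * F = 1`. -/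
theorem sum_mul_eq_one_apply_of_transpose_mul_eq_one {ι κ : Type*} [Fintype ι] [DecidableEq κ]
    {F : Matrix ι κ ℝ} (hF : Fᵀ * F = 1) (a b : κ) :
    ∑ i, F i a * F i b = (1 : Matrix κ κ ℝ) a b := by
  rw [← hF, Matrix.mul_apply]
  rfl

/-- The matrix `V` (given via its transpose `V^T` with block rows
`[√(1/R)·(F^T ⊗ 1_R^T), 0]`, `[−√(2/((R+1)k))·1^T, √(2/((R+1)k))·1^T]`, `[0, F^T]`)
has orthonormal columns: `V^T V = I_{k−1}`. -/
theorem Vmat_orthonormal_columns (m R : ℕ) (hm : 2 ≤ m) (hR : 1 ≤ R)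
    (F : Matrix (Fin m) (Fin (m - 1)) ℝ)
    (hF_orth : Fᵀ * F = 1) (hF_ones : ∀ j, ∑ i, F i j = 0) :
    Vtmat m R F * (Vtmat m R F)ᵀ = 1 := by
  have hR0 : (0 : ℝ) < R := by exact_mod_cast hR
  have hm0 : (0 : ℝ) < m := by exact_mod_cast (by omega : 0 < m)
  have hF := sum_mul_eq_one_apply_of_transpose_mul_eq_one hF_orth
  have hsR : √(1 / (R : ℝ)) * √(1 / (R : ℝ)) = 1 / R := Real.mul_self_sqrt (by positivity)
  have hsm : √(2 / (((R : ℝ) + 1) * (2 * m))) * √(2 / (((R : ℝ) + 1) * (2 * m)))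
      = 2 / (((R : ℝ) + 1) * (2 * m)) := Real.mul_self_sqrt (by positivity)
  ext a b
  rw [Matrix.mul_apply, Fintype.sum_sum_type, Fintype.sum_prod_type]
  rcases a with a | _ | a <;> rcases b with b | _ | b <;>
    simp only [Vtmat, Matrix.of_apply, Matrix.transpose_apply, Finset.sum_const,
      Finset.card_univ, Fintype.card_fin, nsmul_eq_mul, mul_zero, zero_mul, add_zero, zero_add,
      ← Finset.mul_sum, ← Finset.sum_mul, hF, hF_ones, neg_mul_neg, hsm]
  · simp only [mul_mul_mul_comm √(1 / (R : ℝ)) _ √(1 / (R : ℝ)), hsR, ← Finset.mul_sum, hF]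
    rw [← mul_assoc, mul_one_div_cancel hR0.ne', one_mul]
    simp [Matrix.one_apply]
  · simp
  · simp
  · simp
  · rw [Matrix.one_apply_eq]
    field_simp
  · simp
  · simp
  · simp
  · simp [Matrix.one_apply]

end
end

section
/- The SEL matrix Z has rank k−1, and its nonzero singular values are exactly √R with multiplicity k/2−1, √((R+1)/2) with multiplicity 1, and 1 with multiplicity k/2−1; equivalently, the eigenvalues of Z Z^T are R (multiplicity k/2−1), (R+1)/2 (multiplicity 1), 1 (multiplicity k/2−1), and 0 (multiplicity 1). -/
open Matrix Real

noncomputable section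

namespace Matrix

/-- The rank of an idempotent matrix over a field is its trace. -/
theorem rank_eq_trace_of_isIdempotentElem {ι K : Type*} [Fintype ι] [DecidableEq ι] [Field K]
    {A : Matrix ι ι K} (hA : IsIdempotentElem A) : (A.rank : K) = A.trace := by
  have h : IsIdempotentElem (toLin' A) := by
    rw [IsIdempotentElem, Module.End.mul_eq_comp, ← toLin'_mul, hA.eq]
  have htr := ((LinearMap.isProj_range_iff_isIdempotentElem _).2 h).trace
  rw [trace_toLin'_eq] at htr
  rw [htr]
  rfl

/-- The **matrix determinant lemma** for an invertible diagonal matrix. -/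
theorem det_diagonal_add_vecMulVec {ι K : Type*} [Fintype ι] [DecidableEq ι] [Field K]
    (a u v : ι → K) (ha : ∀ i, a i ≠ 0) :
    (diagonal a + vecMulVec u v).det = (∏ i, a i) * (1 + ∑ i, v i * u i / a i) := by
  have h : diagonal a + vecMulVec u v =
      diagonal a * (1 + replicateCol Unit (fun i => u i / a i) * replicateRow Unit v) := by
    rw [← vecMulVec_eq, mul_add, mul_one]
    congr 1
    ext i j
    rw [diagonal_mul, vecMulVec_apply, vecMulVec_apply]
    rw [← mul_assoc, mul_div_cancel₀ _ (ha i)]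
  rw [h, det_mul, det_diagonal, det_one_add_replicateCol_mul_replicateRow]
  simp [dotProduct, mul_div_assoc]

end Matrix

/-- The orthogonal projection onto the sum-zero vectors indexed by the `2m` classes. -/
def centering (m : ℕ) : Matrix (ClassIdx m) (ClassIdx m) ℝ :=
  1 - (2 * (m : ℝ))⁻¹ • Matrix.of fun _ _ => (1 : ℝ)

/-- The class sizes: `R` for a majority class and `1` for a minority class. -/
def classSize (m R : ℕ) : ClassIdx m → ℝ :=
  Sum.elim (fun _ => (R : ℝ)) fun _ => 1

theorem Zmat_eq (m R : ℕ) : Zmat m R = centering m * Ymat m R := rfl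

theorem centering_transpose (m : ℕ) : (centering m)ᵀ = centering m := by
  ext i j
  simp [centering, Matrix.one_apply, eq_comm]

theorem isIdempotentElem_centering {m : ℕ} (hm : m ≠ 0) : IsIdempotentElem (centering m) := by
  have hm' : (m : ℝ) ≠ 0 := Nat.cast_ne_zero.2 hm
  have h : (Matrix.of fun _ _ => (1 : ℝ) : Matrix (ClassIdx m) (ClassIdx m) ℝ) *
      (Matrix.of fun _ _ => (1 : ℝ)) = (2 * (m : ℝ)) • Matrix.of fun _ _ => (1 : ℝ) := by
    ext i j
    simp [Matrix.mul_apply, two_mul]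
  unfold centering
  apply IsIdempotentElem.one_sub
  rw [IsIdempotentElem, Matrix.smul_mul, Matrix.mul_smul, h, smul_smul (2 * (m : ℝ))⁻¹ (2 * m),
    inv_mul_cancel₀ (by positivity), one_smul]

theorem rank_centering {m : ℕ} (hm : m ≠ 0) : (centering m).rank = 2 * m - 1 := by
  have hm' : (m : ℝ) ≠ 0 := Nat.cast_ne_zero.2 hm
  have h := Matrix.rank_eq_trace_of_isIdempotentElem (isIdempotentElem_centering hm)
  have ht : (centering m).trace = 2 * m - 1 := by
    simp [centering, Matrix.trace, Finset.sum_sub_distrib]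
    field_simp
    ring
  rw [ht, eq_sub_iff_add_eq] at h
  have : (centering m).rank + 1 = 2 * m := by exact_mod_cast h
  omega

theorem Ymat_mul_transpose (m R : ℕ) :
    Ymat m R * (Ymat m R)ᵀ = Matrix.diagonal (classSize m R) := by
  ext (i | i) (j | j)
  · by_cases h : i = j <;>
      simp [Ymat, classSize, Matrix.mul_apply, Fintype.sum_prod_type, h]
  all_goals simp [Ymat, classSize, Matrix.mul_apply, Matrix.diagonal_apply, eq_comm]

theorem rank_Zmat {m R : ℕ} (hm : m ≠ 0) (hR : R ≠ 0) : (Zmat m R).rank = 2 * m - 1 := by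
  have hdet : (Matrix.diagonal (classSize m R)).det ≠ 0 := by
    simp [classSize, hR]
  rw [← rank_centering hm, Zmat_eq]
  refine le_antisymm (Matrix.rank_mul_le_left _ _) ?_
  rw [← Matrix.rank_mul_eq_left_of_det_ne_zero _ (centering m) hdet, ← Ymat_mul_transpose,
    ← Matrix.mul_assoc]
  exact Matrix.rank_mul_le_left _ _

theorem charpoly_Zmat_mul_transpose {m : ℕ} (R : ℕ) (hm : m ≠ 0) :
    (Zmat m R * (Zmat m R)ᵀ).charpoly =
      (Matrix.diagonal (classSize m R) * centering m).charpoly := by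
  rw [Zmat_eq, Matrix.transpose_mul, centering_transpose, Matrix.mul_assoc,
    Matrix.charpoly_mul_comm, Matrix.mul_assoc, Matrix.mul_assoc,
    (isIdempotentElem_centering hm).eq, ← Matrix.mul_assoc, Ymat_mul_transpose]

theorem det_scalar_sub_diagonal_mul_centering {m : ℕ} (R : ℕ) (hm : m ≠ 0) {t : ℝ}
    (htR : t ≠ R) (ht1 : t ≠ 1) :
    (Matrix.scalar _ t - Matrix.diagonal (classSize m R) * centering m).det =
      (t - R) ^ (m - 1) * (t - (R + 1) / 2) * (t - 1) ^ (m - 1) * t := by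
  have hm' : (m : ℝ) ≠ 0 := Nat.cast_ne_zero.2 hm
  have hR' : t - R ≠ 0 := sub_ne_zero.2 htR
  have h1' : t - 1 ≠ 0 := sub_ne_zero.2 ht1
  have h : Matrix.scalar _ t - Matrix.diagonal (classSize m R) * centering m =
      Matrix.diagonal (fun i => t - classSize m R i) +
        Matrix.vecMulVec (fun i => classSize m R i * (2 * (m : ℝ))⁻¹) fun _ => 1 := by
    ext i j
    by_cases hij : i = j
    · subst hij
      simp [centering, Matrix.vecMulVec_apply]
      ring
    · simp [centering, Matrix.vecMulVec_apply, hij]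
  rw [h, Matrix.det_diagonal_add_vecMulVec _ _ _ (by
    rintro (i | i)
    · exact hR'
    · exact h1')]
  obtain ⟨n, rfl⟩ := Nat.exists_eq_succ_of_ne_zero hm
  simp only [classSize, Fintype.prod_sum_type, Fintype.sum_sum_type, Sum.elim_inl, Sum.elim_inr,
    Finset.prod_const, Finset.sum_const, Finset.card_univ, Fintype.card_fin, nsmul_eq_mul,
    Nat.succ_eq_add_one, Nat.add_sub_cancel, pow_succ] at hm' ⊢
  field_simp
  ring

open Polynomial in
/-- The SEL matrix has rank `k − 1 = 2m − 1`, and the eigenvalues of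
`Z Z^T` are `R` (multiplicity `k/2 − 1`), `(R+1)/2` (multiplicity `1`),
`1` (multiplicity `k/2 − 1`) and `0` (multiplicity `1`); equivalently, the
characteristic polynomial of `Z Z^T` factors accordingly, which encodes that the
nonzero singular values of `Z` are `√R`, `√((R+1)/2)` and `1` with these
multiplicities. -/
theorem sel_matrix_rank_and_spectrum (m R : ℕ) (hm : 2 ≤ m) (hR : 1 ≤ R) :
    (Zmat m R).rank = 2 * m - 1 ∧
    (Zmat m R * (Zmat m R)ᵀ).charpoly =
      (X - C (R : ℝ)) ^ (m - 1) * (X - C (((R : ℝ) + 1) / 2)) *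
        (X - C 1) ^ (m - 1) * X := by
  have hm0 : m ≠ 0 := by omega
  refine ⟨rank_Zmat hm0 (by omega), ?_⟩
  rw [charpoly_Zmat_mul_transpose R hm0]
  refine Polynomial.eq_of_infinite_eval_eq _ _ ?_
  refine ((Set.toFinite {(R : ℝ), 1}).infinite_compl).mono fun t ht => ?_
  simp only [Set.mem_compl_iff, Set.mem_insert_iff, Set.mem_singleton_iff, not_or] at ht
  simp only [Set.mem_ofPred_eq, Matrix.eval_charpoly, eval_mul, eval_pow, eval_sub, eval_X, eval_C]
  exact det_scalar_sub_diagonal_mul_centering R hm0 ht.1 ht.2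

end
end

section
/- The right singular vectors diagonalize the reweighting: V^T Ω V = Λ, where Λ = diag(√((R+1)/R)·I_{k/2−1}, (√R+1)/√(R+1), √(R+1)·I_{k/2−1}) is the effective weight matrix. -/
open Matrix Real

noncomputable section

/-- Each entry of `V^T Ω V` splits into a majority sum and a minority sum. -/
theorem Vtmat_mul_Omegamat_mul_transpose_apply (m R : ℕ)
    (F : Matrix (Fin m) (Fin (m - 1)) ℝ) (a b : SpecIdx m) :
    (Vtmat m R F * Omegamat m R * (Vtmat m R F)ᵀ) a b =
      (∑ c, ∑ r, Vtmat m R F a (Sum.inl (c, r)) * (√((R : ℝ) + 1) * √(1 / (R : ℝ))) *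
        Vtmat m R F b (Sum.inl (c, r))) +
      ∑ c, Vtmat m R F a (Sum.inr c) * √((R : ℝ) + 1) * Vtmat m R F b (Sum.inr c) := by
  rw [Omegamat, Matrix.mul_apply, Fintype.sum_sum_type, Fintype.sum_prod_type]
  simp only [Matrix.mul_diagonal, Matrix.transpose_apply]

/-- The right singular vectors diagonalize the reweighting:
`V^T Ω V = Λ`, where `Λ = diag(√((R+1)/R)·I_{k/2−1}, (√R+1)/√(R+1), √(R+1)·I_{k/2−1})`
is the effective weight matrix. -/
theorem reweighting_diagonalized (m R : ℕ) (hm : 2 ≤ m) (hR : 1 ≤ R)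
    (F : Matrix (Fin m) (Fin (m - 1)) ℝ)
    (hF_orth : Fᵀ * F = 1) (hF_ones : ∀ j, ∑ i, F i j = 0) :
    Vtmat m R F * Omegamat m R * (Vtmat m R F)ᵀ = Lammat m R := by
  have hR0 : (0 : ℝ) < R := by exact_mod_cast hR
  have hm0 : (0 : ℝ) < m := by exact_mod_cast (by omega : 0 < m)
  have hFF : ∀ i j, ∑ c, F c i * F c j = if i = j then 1 else 0 := fun i j => by
    rw [← Matrix.one_apply, ← hF_orth, Matrix.mul_apply]
    rfl
  have hscale : ∀ x i j, ∑ c, F c i * x * F c j = x * if i = j then 1 else 0 := fun x i j => by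
    rw [← hFF, Finset.mul_sum]
    exact Finset.sum_congr rfl fun c _ => by ring
  have hmean : ∀ x j, ∑ c, x * F c j = 0 := fun x j => by
    rw [← Finset.mul_sum, hF_ones, mul_zero]
  have hmean' : ∀ x y j, ∑ c, F c j * x * y = 0 := fun x y j => by
    rw [← Finset.sum_mul, ← Finset.sum_mul, hF_ones, zero_mul, zero_mul]
  have hsR : √(R : ℝ) ^ 2 = R := Real.sq_sqrt hR0.le
  have hsR1 : √((R : ℝ) + 1) ^ 2 = R + 1 := Real.sq_sqrt (by positivity)
  have hinv : √(1 / (R : ℝ)) = 1 / √(R : ℝ) := by rw [Real.sqrt_div zero_le_one, Real.sqrt_one]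
  have hq : √(2 / (((R : ℝ) + 1) * (2 * (m : ℝ)))) ^ 2 = 2 / (((R : ℝ) + 1) * (2 * (m : ℝ))) :=
    Real.sq_sqrt (by positivity)
  ext a b
  rw [Vtmat_mul_Omegamat_mul_transpose_apply, Lammat, Matrix.diagonal_apply]
  rcases a with i | ⟨⟨⟩⟩ | i <;> rcases b with j | ⟨⟨⟩⟩ | j <;>
    simp only [Vtmat, lamv, Matrix.of_apply, Finset.sum_const, Finset.card_univ, Fintype.card_fin,
      nsmul_eq_mul, zero_mul, mul_zero, add_zero, zero_add, hscale, hmean,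
      Sum.inl.injEq, Sum.inr.injEq, reduceCtorEq, if_false, if_true, mul_ite, mul_one, hmean']
  · have hlam : √(((R : ℝ) + 1) / R) = √((R : ℝ) + 1) / √(R : ℝ) :=
      Real.sqrt_div (by positivity) _
    calc
      _ = ∑ c, F c i * (√(R : ℝ) ^ 2 * (1 / √(R : ℝ)) ^ 3 * √((R : ℝ) + 1)) * F c j :=
        Finset.sum_congr rfl fun c _ => by rw [hinv, hsR]; ring
      _ = √(((R : ℝ) + 1) / R) * if i = j then 1 else 0 := by
        rw [hscale, hlam]
        congr 1
        field_simp
      _ = _ := mul_ite_zero .. |>.trans (by rw [mul_one])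
  · rw [← hmean' (R * √(1 / (R : ℝ)) * (√((R : ℝ) + 1) * √(1 / (R : ℝ))))
      (-√(2 / (((R : ℝ) + 1) * (2 * (m : ℝ))))) i]
    exact Finset.sum_congr rfl fun c _ => by ring
  · rw [← hmean (R * (-√(2 / (((R : ℝ) + 1) * (2 * (m : ℝ)))) *
      (√((R : ℝ) + 1) * √(1 / (R : ℝ))) * √(1 / (R : ℝ)))) j]
    exact Finset.sum_congr rfl fun c _ => by ring
  · calc
      _ = √(2 / (((R : ℝ) + 1) * (2 * (m : ℝ)))) ^ 2 * m * √((R : ℝ) + 1) *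
          (R * √(1 / (R : ℝ)) + 1) := by ring
      _ = 2 / (√((R : ℝ) + 1) ^ 2 * (2 * (m : ℝ))) * m * √((R : ℝ) + 1) *
          (√(R : ℝ) ^ 2 * (1 / √(R : ℝ)) + 1) := by rw [hq, hinv, hsR1, hsR]
      _ = _ := by field_simp

end
end

section
/- For reals σ > 0, λ > 0, and δ, the function w(t) = √(σ/(1 + (σe^{2δ} − 1)e^{−2σλt})) is well defined on [0, ∞), satisfies the initial condition w(0) = e^{−δ}, and is differentiable with w'(t) = λ·w(t)·(σ − w(t)^2) for all t ≥ 0. Consequently the pair (w̄_i, h̄_i) = (w, w) solves the decoupled gradient-flow system w̄' = (σ − w̄h̄)·λ·h̄, h̄' = w̄·(σ − w̄h̄)·λ with w̄(0) = h̄(0) = e^{−δ}. -/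
open Real Filter

noncomputable section

/-- Per-mode scalar trajectory `w(t) = √(σ/(1 + (σe^{2δ} − 1)e^{−2σλt}))`. -/
def modeWeight (σ lam δ : ℝ) (t : ℝ) : ℝ :=
  Real.sqrt (σ / (1 + (σ * Real.exp (2 * δ) - 1) * Real.exp (-(2 * σ * lam * t))))

theorem modeWeight_denom_pos {σ lam : ℝ} (δ : ℝ) (hσ : 0 < σ) (hlam : 0 < lam) {t : ℝ}
    (ht : 0 ≤ t) :
    0 < 1 + (σ * Real.exp (2 * δ) - 1) * Real.exp (-(2 * σ * lam * t)) := by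
  have hle : Real.exp (-(2 * σ * lam * t)) ≤ 1 :=
    Real.exp_le_one_iff.2 (neg_nonpos.2 (by positivity))
  have hpos : 0 < σ * Real.exp (2 * δ) * Real.exp (-(2 * σ * lam * t)) := by positivity
  linarith

theorem modeWeight_zero {σ : ℝ} (lam δ : ℝ) (hσ : 0 < σ) :
    modeWeight σ lam δ 0 = Real.exp (-δ) := by
  have h : σ / (1 + (σ * Real.exp (2 * δ) - 1) * Real.exp (-(2 * σ * lam * 0))) =
      Real.exp (-δ) ^ 2 := by
    have hexp : Real.exp (-δ) ^ 2 * Real.exp (2 * δ) = 1 := by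
      rw [← Real.exp_nat_mul, ← Real.exp_add]
      simp
    rw [mul_zero, neg_zero, Real.exp_zero, mul_one, add_sub_cancel, div_eq_iff (by positivity)]
    linear_combination -σ * hexp
  rw [modeWeight, h, Real.sqrt_sq (Real.exp_pos _).le]

theorem hasDerivAt_modeWeight {σ lam δ t : ℝ} (hσ : 0 < σ)
    (hD : 0 < 1 + (σ * Real.exp (2 * δ) - 1) * Real.exp (-(2 * σ * lam * t))) :
    HasDerivAt (modeWeight σ lam δ)
      (lam * modeWeight σ lam δ t * (σ - (modeWeight σ lam δ t) ^ 2)) t := by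
  have hlin : HasDerivAt (fun s : ℝ => -(2 * σ * lam * s)) (-(2 * σ * lam)) t := by
    simpa using ((hasDerivAt_id t).const_mul (2 * σ * lam)).fun_neg
  have hden := (hlin.exp.const_mul (σ * Real.exp (2 * δ) - 1)).const_add 1
  have hquot := (hasDerivAt_const t σ).fun_div hden hD.ne'
  have hw := hquot.sqrt (div_pos hσ hD).ne'
  have hwpos : 0 < modeWeight σ lam δ t := Real.sqrt_pos.2 (div_pos hσ hD)
  have hsq : modeWeight σ lam δ t ^ 2 =
      σ / (1 + (σ * Real.exp (2 * δ) - 1) * Real.exp (-(2 * σ * lam * t))) :=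
    Real.sq_sqrt (div_pos hσ hD).le
  refine hw.congr_deriv ?_
  change _ / (2 * modeWeight σ lam δ t) = _
  rw [div_eq_iff (by positivity)]
  rw [show ∀ w : ℝ, lam * w * (σ - w ^ 2) * (2 * w) = 2 * lam * w ^ 2 * (σ - w ^ 2) from
    fun w => by ring, hsq]
  have hD' := hD.ne'
  generalize Real.exp (-(2 * σ * lam * t)) = e at hD' ⊢
  generalize Real.exp (2 * δ) = c at hD' ⊢
  field_simp
  ring

/-- For reals `σ > 0`, `λ > 0` and `δ`, the function
`w(t) = √(σ/(1 + (σe^{2δ} − 1)e^{−2σλt}))` is well defined on `[0, ∞)` (the denominator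
is strictly positive there), satisfies `w(0) = e^{−δ}`, and is differentiable with
`w'(t) = λ·w(t)·(σ − w(t)^2)` for all `t ≥ 0`. Consequently the pair
`(w̄, h̄) = (w, w)` solves the decoupled gradient-flow system
`w̄' = (σ − w̄h̄)·λ·h̄`, `h̄' = w̄·(σ − w̄h̄)·λ` with `w̄(0) = h̄(0) = e^{−δ}`. -/
theorem modeWeight_ode (σ lam δ : ℝ) (hσ : 0 < σ) (hlam : 0 < lam) :
    (∀ t : ℝ, 0 ≤ t → 0 < 1 + (σ * Real.exp (2 * δ) - 1) * Real.exp (-(2 * σ * lam * t))) ∧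
    modeWeight σ lam δ 0 = Real.exp (-δ) ∧
    (∀ t : ℝ, 0 ≤ t →
      HasDerivAt (modeWeight σ lam δ)
        (lam * modeWeight σ lam δ t * (σ - (modeWeight σ lam δ t) ^ 2)) t) ∧
    (∀ t : ℝ, 0 ≤ t →
      HasDerivAt (modeWeight σ lam δ)
        ((σ - modeWeight σ lam δ t * modeWeight σ lam δ t) * lam * modeWeight σ lam δ t) t ∧
      HasDerivAt (modeWeight σ lam δ)
        (modeWeight σ lam δ t *
          ((σ - modeWeight σ lam δ t * modeWeight σ lam δ t) * lam)) t) := by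
  refine ⟨fun t ht => modeWeight_denom_pos δ hσ hlam ht, modeWeight_zero lam δ hσ,
    fun t ht => hasDerivAt_modeWeight hσ (modeWeight_denom_pos δ hσ hlam ht), fun t ht => ?_⟩
  have h := hasDerivAt_modeWeight hσ (modeWeight_denom_pos δ hσ hlam ht)
  exact ⟨h.congr_deriv (by ring), h.congr_deriv (by ring)⟩

end
end

section
/- Step-function limit of the time-rescaled mode factors: fix σ > 0 and λ > 0, set T = 1/(σλ), and for each δ > 0 let β_δ(t) = 1/(1 + (σe^{2δ} − 1)e^{−2σλ·δt}). Then as δ → ∞: (i) for every t with 0 ≤ t < T, β_δ(t) → 0; (ii) for every t > T, β_δ(t) → 1; and (iii) at t = T, β_δ(T) → 1/(1 + σ). -/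
open Real Filter Topology

noncomputable section

/-- Time-rescaled spectral mode factor `β_δ(t) = 1/(1 + (σe^{2δ} − 1)e^{−2σλ·δt})`. -/
def rescaledModeFactor (σ lam : ℝ) (δ t : ℝ) : ℝ :=
  (1 + (σ * Real.exp (2 * δ) - 1) * Real.exp (-(2 * σ * lam * (δ * t))))⁻¹

theorem rescaledModeFactor_eq (σ lam δ t : ℝ) :
    rescaledModeFactor σ lam δ t =
      (1 + σ * Real.exp (2 * (1 - σ * lam * t) * δ) - Real.exp (-(2 * σ * lam * t) * δ))⁻¹ := by
  have h : Real.exp (2 * (1 - σ * lam * t) * δ) =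
      Real.exp (2 * δ) * Real.exp (-(2 * σ * lam * (δ * t))) := by
    rw [← Real.exp_add]
    ring_nf
  rw [rescaledModeFactor, h,
    show -(2 * σ * lam * t) * δ = -(2 * σ * lam * (δ * t)) by ring]
  ring_nf

theorem tendsto_exp_mul_atTop_nhds_zero {a : ℝ} (ha : a < 0) :
    Tendsto (fun x => Real.exp (a * x)) atTop (nhds 0) :=
  Real.tendsto_exp_atBot.comp (tendsto_id.const_mul_atTop_of_neg ha)

/-- Step-function limit of the time-rescaled mode factors: fix `σ > 0`
and `λ > 0` and set `T = 1/(σλ)`. Then as `δ → ∞`: (i) for every `t` with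
`0 ≤ t < T`, `β_δ(t) → 0`; (ii) for every `t > T`, `β_δ(t) → 1`; and (iii) at
`t = T`, `β_δ(T) → 1/(1 + σ)`. -/
theorem rescaledModeFactor_step_limit (σ lam : ℝ) (hσ : 0 < σ) (hlam : 0 < lam)
    (T : ℝ) (hT : T = 1 / (σ * lam)) :
    (∀ t : ℝ, 0 ≤ t → t < T →
      Tendsto (fun δ => rescaledModeFactor σ lam δ t) atTop (nhds 0)) ∧
    (∀ t : ℝ, T < t →
      Tendsto (fun δ => rescaledModeFactor σ lam δ t) atTop (nhds 1)) ∧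
    Tendsto (fun δ => rescaledModeFactor σ lam δ T) atTop (nhds (1 / (1 + σ))) := by
  have hpos : 0 < σ * lam := mul_pos hσ hlam
  have hT1 : σ * lam * T = 1 := by rw [hT]; field_simp
  simp only [rescaledModeFactor_eq]
  refine ⟨fun t ht0 htT => ?_, fun t htT => ?_, ?_⟩
  · have hc : 0 < 2 * (1 - σ * lam * t) := by
      nlinarith [mul_lt_mul_of_pos_left htT hpos]
    have hlim : Tendsto (fun δ => σ * Real.exp (2 * (1 - σ * lam * t) * δ)) atTop atTop :=
      (Real.tendsto_exp_atTop.comp (tendsto_id.const_mul_atTop hc)).const_mul_atTop hσ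
    refine tendsto_inv_atTop_zero.comp (tendsto_atTop_mono' atTop ?_ hlim)
    filter_upwards [eventually_ge_atTop 0] with δ hδ
    have hexp : Real.exp (-(2 * σ * lam * t) * δ) ≤ 1 := by
      rw [Real.exp_le_one_iff, neg_mul, neg_nonpos]
      positivity
    linarith
  · have hc : 2 * (1 - σ * lam * t) < 0 := by
      nlinarith [mul_lt_mul_of_pos_left htT hpos]
    have hd : -(2 * σ * lam * t) < 0 := by linarith
    have hlim := (((tendsto_exp_mul_atTop_nhds_zero hc).const_mul σ).const_add 1).sub
      (tendsto_exp_mul_atTop_nhds_zero hd)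
    simpa using hlim.inv₀ (by norm_num)
  · have hd : -(2 * σ * lam * T) < 0 := by linarith
    have hlim := (tendsto_exp_mul_atTop_nhds_zero hd).const_sub (1 + σ)
    simpa [hT1] using hlim.inv₀ (by linarith)

end
end

section
/- Closed-form gradient flow for vanilla ERM (unconstrained features, square loss): let d ≥ k−1, let P ∈ ℝ^{d×(k−1)} satisfy P^T P = I_{k−1}, and define for t ≥ 0 the matrices A(t) = diag(a_1(t),…,a_{k−1}(t)) with a_i(t) = 1/(1 + (σ_i e^{2δ} − 1)e^{−2σ_i t}), W(t) = U √Σ √A(t) P^T and H(t) = P √Σ √A(t) V^T. Then W(0) = e^{−δ}·U P^T, H(0) = e^{−δ}·P V^T, and (W(t), H(t)) solves the gradient flow of L(W,H) = ½‖Z − WH‖_F^2, i.e., W'(t) = (Z − W(t)H(t))·H(t)^T and H'(t) = W(t)^T·(Z − W(t)H(t)) for all t ≥ 0. -/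
open Matrix Real

noncomputable section

/-- Mode factor of vanilla ERM: `a_i(t) = 1/(1 + (σ_i e^{2δ} − 1)e^{−2σ_i t})`. -/
def aFactor (m R : ℕ) (δ : ℝ) (j : SpecIdx m) (t : ℝ) : ℝ :=
  (1 + (sigv m R j * Real.exp (2 * δ) - 1) * Real.exp (-(2 * sigv m R j * t)))⁻¹

/-- `W(t) = U √Σ √A(t) P^T`. -/
def Wvanilla (m R d : ℕ) (F : Matrix (Fin m) (Fin (m - 1)) ℝ)
    (P : Matrix (Fin d) (SpecIdx m) ℝ) (δ : ℝ) (t : ℝ) :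
    Matrix (ClassIdx m) (Fin d) ℝ :=
  Umat m F * Matrix.diagonal (fun j => Real.sqrt (sigv m R j)) *
    Matrix.diagonal (fun j => Real.sqrt (aFactor m R δ j t)) * Pᵀ

/-- `H(t) = P √Σ √A(t) V^T`. -/
def Hvanilla (m R d : ℕ) (F : Matrix (Fin m) (Fin (m - 1)) ℝ)
    (P : Matrix (Fin d) (SpecIdx m) ℝ) (δ : ℝ) (t : ℝ) :
    Matrix (Fin d) (SampleIdx m R) ℝ :=
  P * Matrix.diagonal (fun j => Real.sqrt (sigv m R j)) *
    Matrix.diagonal (fun j => Real.sqrt (aFactor m R δ j t)) * Vtmat m R F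

/-- The columns of `F` together with the constant vector resolve the identity. -/
theorem sum_mul_eq_ite_sub_inv {m : ℕ} (hm : m ≠ 0) {F : Matrix (Fin m) (Fin (m - 1)) ℝ}
    (hF_orth : Fᵀ * F = 1) (hF_ones : ∀ j, ∑ i, F i j = 0) (i i' : Fin m) :
    ∑ j, F i j * F i' j = (if i = i' then 1 else 0) - (m : ℝ)⁻¹ := by
  have e : Fin m ≃ Fin (m - 1) ⊕ Unit :=
    Fintype.equivOfCardEq (by simp; omega)
  have hm' : (m : ℝ) ≠ 0 := Nat.cast_ne_zero.mpr hm
  have h := (fromCols_mul_fromRows_eq_one_comm e F (Matrix.of fun _ (_ : Unit) => (1 : ℝ))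
    Fᵀ (Matrix.of fun _ _ => (m : ℝ)⁻¹)).mpr (by
      rw [fromRows_mul_fromCols, hF_orth, ← fromBlocks_one]
      congr 1 <;> ext a b <;> simp [Matrix.mul_apply, ← Finset.mul_sum, hF_ones, hm'])
  rw [fromCols_mul_fromRows] at h
  have h' := congr_fun (congr_fun h i) i'
  simp [Matrix.mul_apply, Matrix.one_apply] at h'
  linarith

theorem sum_mul_eq_one_apply {m : ℕ} {F : Matrix (Fin m) (Fin (m - 1)) ℝ}
    (hF_orth : Fᵀ * F = 1) (j j' : Fin (m - 1)) :
    ∑ i, F i j * F i j' = (1 : Matrix (Fin (m - 1)) (Fin (m - 1)) ℝ) j j' := by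
  rw [← hF_orth, Matrix.mul_apply]; rfl

theorem Umat_transpose_mul_self {m : ℕ} (hm : m ≠ 0) {F : Matrix (Fin m) (Fin (m - 1)) ℝ}
    (hF_orth : Fᵀ * F = 1) (hF_ones : ∀ j, ∑ i, F i j = 0) :
    (Umat m F)ᵀ * Umat m F = 1 := by
  have hm' : (m : ℝ) ≠ 0 := Nat.cast_ne_zero.mpr hm
  have hs : √(1 / (2 * (m : ℝ))) * √(1 / (2 * (m : ℝ))) = 1 / (2 * m) :=
    Real.mul_self_sqrt (by positivity)
  ext (j | _ | j) (j' | _ | j') <;>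
    simp only [Matrix.mul_apply, Matrix.transpose_apply, Umat, Matrix.of_apply,
      Fintype.sum_sum_type, ← Finset.mul_sum, ← Finset.sum_mul, hF_ones,
      sum_mul_eq_one_apply hF_orth, Matrix.one_apply, Finset.sum_const, Finset.card_univ,
      Fintype.card_fin, nsmul_eq_mul, neg_mul_neg, hs, Sum.inl.injEq, Sum.inr.injEq,
      reduceCtorEq, if_false, mul_zero, zero_mul, add_zero, zero_add, if_true]
  field_simp
  norm_num

theorem Vtmat_mul_transpose_self {m R : ℕ} (hm : m ≠ 0) (hR : R ≠ 0)
    {F : Matrix (Fin m) (Fin (m - 1)) ℝ}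
    (hF_orth : Fᵀ * F = 1) (hF_ones : ∀ j, ∑ i, F i j = 0) :
    Vtmat m R F * (Vtmat m R F)ᵀ = 1 := by
  have hm' : (m : ℝ) ≠ 0 := Nat.cast_ne_zero.mpr hm
  have hR' : (R : ℝ) ≠ 0 := Nat.cast_ne_zero.mpr hR
  have hs : √(2 / (((R : ℝ) + 1) * (2 * (m : ℝ)))) * √(2 / (((R : ℝ) + 1) * (2 * (m : ℝ)))) =
      2 / (((R : ℝ) + 1) * (2 * m)) := Real.mul_self_sqrt (by positivity)
  have hr (x y : ℝ) : √(1 / (R : ℝ)) * x * (√(1 / (R : ℝ)) * y) = 1 / R * (x * y) := by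
    rw [mul_mul_mul_comm, Real.mul_self_sqrt (by positivity)]
  ext (j | _ | j) (j' | _ | j') <;>
    simp only [Matrix.mul_apply, Matrix.transpose_apply, Vtmat, Matrix.of_apply,
      Fintype.sum_sum_type, Fintype.sum_prod_type, ← Finset.mul_sum, ← Finset.sum_mul, hF_ones,
      sum_mul_eq_one_apply hF_orth, Matrix.one_apply, Finset.sum_const, Finset.card_univ,
      Fintype.card_fin, nsmul_eq_mul, neg_mul_neg, hs, hr,
      Sum.inl.injEq, Sum.inr.injEq,
      reduceCtorEq, if_false, mul_zero, zero_mul, add_zero, zero_add, if_true]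
  · simp_rw [mul_left_comm _ (R : ℝ), ← Finset.mul_sum]
    rw [sum_mul_eq_one_apply hF_orth, Matrix.one_apply, one_div, inv_mul_cancel_left₀ hR']
  · rw [Fintype.card_prod, Fintype.card_fin, Fintype.card_fin]
    push_cast
    field_simp

/-- Singular value decomposition of the SEL matrix. -/
theorem Zmat_eq_svd {m R : ℕ} (hm : m ≠ 0) (hR : R ≠ 0) {F : Matrix (Fin m) (Fin (m - 1)) ℝ}
    (hF_orth : Fᵀ * F = 1) (hF_ones : ∀ j, ∑ i, F i j = 0) :
    Zmat m R = Umat m F * Sigmat m R * Vtmat m R F := by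
  have hm' : (m : ℝ) ≠ 0 := Nat.cast_ne_zero.mpr hm
  have hR' : (R : ℝ) ≠ 0 := Nat.cast_ne_zero.mpr hR
  have hr : √(R : ℝ) * √(1 / (R : ℝ)) = 1 := by
    rw [← Real.sqrt_mul (by positivity), mul_one_div_cancel hR', Real.sqrt_one]
  have hc : √(1 / (2 * (m : ℝ))) * √(((R : ℝ) + 1) / 2) *
      √(2 / (((R : ℝ) + 1) * (2 * (m : ℝ)))) = (2 * (m : ℝ))⁻¹ := by
    rw [← Real.sqrt_mul (by positivity), ← Real.sqrt_mul (by positivity),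
      show 1 / (2 * (m : ℝ)) * (((R : ℝ) + 1) / 2) * (2 / (((R : ℝ) + 1) * (2 * (m : ℝ)))) =
        ((2 * (m : ℝ))⁻¹) ^ 2 by field_simp, Real.sqrt_sq (by positivity)]
  have hh : (m : ℝ)⁻¹ = (2 * (m : ℝ))⁻¹ + (2 * (m : ℝ))⁻¹ := by field_simp; norm_num
  have hF := sum_mul_eq_ite_sub_inv hm hF_orth hF_ones
  have hF' (i c : Fin m) : ∑ j, F i j * √(R : ℝ) * (√(1 / (R : ℝ)) * F c j) =
      (if i = c then 1 else 0) - (m : ℝ)⁻¹ := by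
    rw [← hF]
    refine Finset.sum_congr rfl fun j _ => ?_
    rw [mul_assoc, ← mul_assoc √(R : ℝ), hr, one_mul]
  rw [Zmat, Sigmat]
  ext (i | i) (⟨c, r⟩ | c) <;>
    rw [Matrix.mul_apply, Matrix.mul_apply] <;>
    simp only [Matrix.mul_diagonal, Matrix.sub_apply, Matrix.one_apply, Matrix.smul_apply, Umat,
      Ymat, Vtmat, sigv, Matrix.of_apply, Fintype.sum_sum_type, Finset.univ_unique,
      Finset.sum_singleton, neg_mul, mul_neg, neg_neg, hc, hF, hF', hh, mul_zero, zero_mul,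
      Finset.sum_const_zero, add_zero, zero_add, Finset.sum_neg_distrib, mul_one, smul_eq_mul,
      sub_mul, mul_ite, Finset.sum_sub_distrib, Finset.sum_ite_eq', Finset.mem_univ, if_true,
      Sum.inl.injEq, Sum.inr.injEq, reduceCtorEq, if_false] <;>
    ring

theorem sigv_pos {m R : ℕ} (hR : R ≠ 0) (j : SpecIdx m) : 0 < sigv m R j := by
  rcases j with j | _ | j <;> simp only [sigv] <;> positivity

theorem aFactor_denom_pos {m R : ℕ} (hR : R ≠ 0) (δ : ℝ) (j : SpecIdx m) {t : ℝ} (ht : 0 ≤ t) :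
    0 < 1 + (sigv m R j * exp (2 * δ) - 1) * exp (-(2 * sigv m R j * t)) := by
  have hσ := sigv_pos hR j
  have h1 : exp (-(2 * sigv m R j * t)) ≤ 1 := Real.exp_le_one_iff.mpr (by
    have : 0 ≤ 2 * sigv m R j * t := by positivity
    linarith)
  have h2 : 0 < sigv m R j * exp (2 * δ) * exp (-(2 * sigv m R j * t)) := by positivity
  linarith

/-- The mode amplitude `√σ_j √a_j(t)`. -/
def modeAmp (m R : ℕ) (δ : ℝ) (t : ℝ) (j : SpecIdx m) : ℝ :=
  √(sigv m R j) * √(aFactor m R δ j t)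

theorem modeAmp_zero {m R : ℕ} (hR : R ≠ 0) (δ : ℝ) (j : SpecIdx m) :
    modeAmp m R δ 0 j = exp (-δ) := by
  have hσ := sigv_pos hR j
  rw [modeAmp, aFactor, ← Real.sqrt_mul hσ.le,
    show sigv m R j * (1 + (sigv m R j * exp (2 * δ) - 1) * exp (-(2 * sigv m R j * 0)))⁻¹ =
      exp (-δ) ^ 2 by
        rw [mul_zero, neg_zero, Real.exp_zero, mul_one, add_sub_cancel, mul_inv,
          mul_inv_cancel_left₀ hσ.ne', ← Real.exp_neg, ← Real.exp_nat_mul]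
        congr 1; push_cast; ring,
    Real.sqrt_sq (Real.exp_pos _).le]

theorem hasDerivAt_aFactor {m R : ℕ} (hR : R ≠ 0) (δ : ℝ) (j : SpecIdx m) {t : ℝ} (ht : 0 ≤ t) :
    HasDerivAt (aFactor m R δ j)
      (2 * sigv m R j * aFactor m R δ j t * (1 - aFactor m R δ j t)) t := by
  have hD := aFactor_denom_pos hR δ j ht
  have h := ((((((hasDerivAt_id t).const_mul (2 * sigv m R j)).fun_neg).exp).const_mul
    (sigv m R j * exp (2 * δ) - 1)).const_add 1).fun_inv hD.ne'
  refine h.congr_deriv ?_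
  simp only [aFactor, id]
  have hD' := hD.ne'
  generalize exp (-(2 * sigv m R j * t)) = E at hD' ⊢
  generalize hDdef : 1 + (sigv m R j * exp (2 * δ) - 1) * E = D at hD' ⊢
  field_simp
  rw [← hDdef]
  ring

theorem hasDerivAt_modeAmp {m R : ℕ} (hR : R ≠ 0) (δ : ℝ) (j : SpecIdx m) {t : ℝ} (ht : 0 ≤ t) :
    HasDerivAt (fun s => modeAmp m R δ s j)
      ((sigv m R j - modeAmp m R δ t j * modeAmp m R δ t j) * modeAmp m R δ t j) t := by
  have ha : 0 < aFactor m R δ j t := inv_pos.mpr (aFactor_denom_pos hR δ j ht)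
  have h := ((hasDerivAt_aFactor hR δ j ht).sqrt ha.ne').const_mul √(sigv m R j)
  refine h.congr_deriv ?_
  have hσ := Real.mul_self_sqrt (sigv_pos hR j).le
  have hsa := Real.mul_self_sqrt ha.le
  have hne := (Real.sqrt_pos.mpr ha).ne'
  rw [modeAmp, mul_mul_mul_comm, hσ, hsa]
  field_simp
  rw [Real.sq_sqrt ha.le]
  ring

theorem Wvanilla_eq (m R d : ℕ) (F : Matrix (Fin m) (Fin (m - 1)) ℝ)
    (P : Matrix (Fin d) (SpecIdx m) ℝ) (δ t : ℝ) :
    Wvanilla m R d F P δ t = Umat m F * Matrix.diagonal (modeAmp m R δ t) * Pᵀ := by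
  rw [Wvanilla, Matrix.mul_assoc (Umat m F), Matrix.diagonal_mul_diagonal]
  rfl

theorem Hvanilla_eq (m R d : ℕ) (F : Matrix (Fin m) (Fin (m - 1)) ℝ)
    (P : Matrix (Fin d) (SpecIdx m) ℝ) (δ t : ℝ) :
    Hvanilla m R d F P δ t = P * Matrix.diagonal (modeAmp m R δ t) * Vtmat m R F := by
  rw [Hvanilla, Matrix.mul_assoc P, Matrix.diagonal_mul_diagonal]
  rfl

theorem hasDerivAt_mul_diagonal_mul_apply {ι κ l : Type*} [Fintype κ] [DecidableEq κ]
    (A : Matrix ι κ ℝ) (B : Matrix κ l ℝ) {w : ℝ → κ → ℝ} {w' : κ → ℝ} {t : ℝ}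
    (hw : ∀ j, HasDerivAt (fun s => w s j) (w' j) t) (i : ι) (j : l) :
    HasDerivAt (fun s => (A * Matrix.diagonal (w s) * B) i j)
      ((A * Matrix.diagonal w' * B) i j) t := by
  simp only [Matrix.mul_apply (N := B), Matrix.mul_diagonal]
  exact HasDerivAt.fun_sum fun x _ => ((hw x).const_mul (A i x)).mul_const (B x j)

theorem residual_eq {c n d κ : Type*} [Fintype d] [Fintype κ] [DecidableEq κ]
    {U : Matrix c κ ℝ} {V : Matrix κ n ℝ} {P : Matrix d κ ℝ}
    (hP : Pᵀ * P = 1) (σ w : κ → ℝ) :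
    U * Matrix.diagonal σ * V -
        U * Matrix.diagonal w * Pᵀ * (P * Matrix.diagonal w * V) =
      U * Matrix.diagonal (fun j => σ j - w j * w j) * V := by
  have h : U * Matrix.diagonal w * Pᵀ * (P * Matrix.diagonal w * V) =
      U * (Matrix.diagonal w * (Pᵀ * P) * Matrix.diagonal w) * V := by
    simp only [Matrix.mul_assoc]
  rw [h, hP, Matrix.mul_one, Matrix.diagonal_mul_diagonal, ← Matrix.sub_mul, ← Matrix.mul_sub,
    Matrix.diagonal_sub]

theorem residual_mul_transpose {c n d κ : Type*} [Fintype n] [Fintype κ] [DecidableEq κ]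
    {U : Matrix c κ ℝ} {V : Matrix κ n ℝ} {P : Matrix d κ ℝ}
    (hV : V * Vᵀ = 1) (g w : κ → ℝ) :
    U * Matrix.diagonal g * V * (P * Matrix.diagonal w * V)ᵀ =
      U * Matrix.diagonal (fun j => g j * w j) * Pᵀ := by
  have h : U * Matrix.diagonal g * V * (P * Matrix.diagonal w * V)ᵀ =
      U * (Matrix.diagonal g * (V * Vᵀ) * Matrix.diagonal w) * Pᵀ := by
    simp only [Matrix.transpose_mul, Matrix.diagonal_transpose, Matrix.mul_assoc]
  rw [h, hV, Matrix.mul_one, Matrix.diagonal_mul_diagonal]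

theorem transpose_mul_residual {c n d κ : Type*} [Fintype c] [Fintype κ] [DecidableEq κ]
    {U : Matrix c κ ℝ} {V : Matrix κ n ℝ} {P : Matrix d κ ℝ}
    (hU : Uᵀ * U = 1) (g w : κ → ℝ) :
    (U * Matrix.diagonal w * Pᵀ)ᵀ * (U * Matrix.diagonal g * V) =
      P * Matrix.diagonal (fun j => g j * w j) * V := by
  have h : (U * Matrix.diagonal w * Pᵀ)ᵀ * (U * Matrix.diagonal g * V) =
      P * (Matrix.diagonal w * (Uᵀ * U) * Matrix.diagonal g) * V := by
    simp only [Matrix.transpose_mul, Matrix.transpose_transpose, Matrix.diagonal_transpose,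
      Matrix.mul_assoc]
  rw [h, hU, Matrix.mul_one, Matrix.diagonal_mul_diagonal]
  simp only [mul_comm (w _)]

/-- Closed-form gradient flow for vanilla ERM (unconstrained
features, square loss): with `d ≥ k − 1`, `P^T P = I_{k−1}`, and
`W(t) = U √Σ √A(t) P^T`, `H(t) = P √Σ √A(t) V^T`, where
`A(t) = diag(a_i(t))` and `a_i(t) = 1/(1 + (σ_i e^{2δ} − 1)e^{−2σ_i t})`, one has
`W(0) = e^{−δ}·U P^T`, `H(0) = e^{−δ}·P V^T`, and `(W, H)` solves the gradient flow
of `L(W,H) = ½‖Z − WH‖_F²`, i.e. `W'(t) = (Z − W(t)H(t))·H(t)^T` and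
`H'(t) = W(t)^T·(Z − W(t)H(t))` for all `t ≥ 0` (entrywise derivatives). -/
theorem vanilla_gradient_flow_closed_form (m R d : ℕ) (hm : 2 ≤ m) (hR : 1 ≤ R)
    (hd : 2 * m - 1 ≤ d)
    (F : Matrix (Fin m) (Fin (m - 1)) ℝ)
    (hF_orth : Fᵀ * F = 1) (hF_ones : ∀ j, ∑ i, F i j = 0)
    (P : Matrix (Fin d) (SpecIdx m) ℝ) (hP : Pᵀ * P = 1) (δ : ℝ) :
    Wvanilla m R d F P δ 0 = Real.exp (-δ) • (Umat m F * Pᵀ) ∧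
    Hvanilla m R d F P δ 0 = Real.exp (-δ) • (P * Vtmat m R F) ∧
    (∀ t : ℝ, 0 ≤ t →
      (∀ i j, HasDerivAt (fun s => Wvanilla m R d F P δ s i j)
        (((Zmat m R - Wvanilla m R d F P δ t * Hvanilla m R d F P δ t) *
          (Hvanilla m R d F P δ t)ᵀ) i j) t) ∧
      (∀ i j, HasDerivAt (fun s => Hvanilla m R d F P δ s i j)
        (((Wvanilla m R d F P δ t)ᵀ *
          (Zmat m R - Wvanilla m R d F P δ t * Hvanilla m R d F P δ t)) i j) t)) := by
  have hm0 : m ≠ 0 := by omega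
  have hR0 : R ≠ 0 := by omega
  have h0 : Matrix.diagonal (modeAmp m R δ 0) =
      exp (-δ) • (1 : Matrix (SpecIdx m) (SpecIdx m) ℝ) := by
    rw [funext (modeAmp_zero hR0 δ), Matrix.smul_one_eq_diagonal]
  simp only [Wvanilla_eq, Hvanilla_eq, Zmat_eq_svd hm0 hR0 hF_orth hF_ones, Sigmat,
    residual_eq hP, residual_mul_transpose (Vtmat_mul_transpose_self hm0 hR0 hF_orth hF_ones),
    transpose_mul_residual (Umat_transpose_mul_self hm0 hF_orth hF_ones)]
  refine ⟨by simp [h0], by simp [h0], fun t ht => ⟨?_, ?_⟩⟩ <;>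
    exact hasDerivAt_mul_diagonal_mul_apply _ _ fun j => hasDerivAt_modeAmp hR0 δ j ht

end
end

section
/- Vanilla learning times (Corollary, vanilla part): under vanilla ERM in the vanishing-initialization limit, the i-th spectral mode is learned at time T_i = 1/σ_i; hence the maj-maj features are learned at time 1/√R, the maj-min feature at time √(2/(R+1)), and the min-min features at time 1, and for every R > 1 these times are strictly ordered: 1/√R < √(2/(R+1)) < 1. -/
open Real Filter Topology

noncomputable section

/-- Time-rescaled spectral mode factor of vanilla ERM (`λ = 1`):
`β_δ(t) = 1/(1 + (σe^{2δ} − 1)e^{−2σ·δt})`. -/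
def vanillaRescaledModeFactor (σ : ℝ) (δ t : ℝ) : ℝ :=
  (1 + (σ * Real.exp (2 * δ) - 1) * Real.exp (-(2 * σ * (δ * t))))⁻¹

theorem vanillaRescaledModeFactor_eq (σ δ t : ℝ) :
    vanillaRescaledModeFactor σ δ t =
      (1 + σ * Real.exp (2 * (1 - σ * t) * δ) - Real.exp (-(2 * (σ * t)) * δ))⁻¹ := by
  have h : Real.exp (2 * (1 - σ * t) * δ)
      = Real.exp (2 * δ) * Real.exp (-(2 * (σ * t)) * δ) := by
    rw [← Real.exp_add]; ring_nf
  have h' : -(2 * σ * (δ * t)) = -(2 * (σ * t)) * δ := by ring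
  rw [vanillaRescaledModeFactor, h, h']
  ring_nf

theorem tendsto_vanillaRescaledModeFactor_zero {σ t : ℝ} (hσ : 0 < σ) (ht : 0 ≤ t)
    (h : t < 1 / σ) : Tendsto (fun δ => vanillaRescaledModeFactor σ δ t) atTop (𝓝 0) := by
  have hlt : 0 < 2 * (1 - σ * t) := by
    rw [lt_div_iff₀ hσ] at h
    linarith
  simp only [vanillaRescaledModeFactor_eq]
  refine tendsto_inv_atTop_zero.comp (tendsto_atTop_mono' _ ?_
    ((Real.tendsto_exp_atTop.comp (tendsto_id.const_mul_atTop hlt)).const_mul_atTop hσ))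
  filter_upwards [eventually_ge_atTop 0] with δ hδ
  have hle : Real.exp (-(2 * (σ * t)) * δ) ≤ 1 :=
    Real.exp_le_one_iff.2 (by nlinarith [mul_nonneg (mul_nonneg hσ.le ht) hδ])
  simp only [Function.comp_apply, id_eq]
  linarith

theorem tendsto_exp_const_mul_atTop_of_neg {c : ℝ} (hc : c < 0) :
    Tendsto (fun x : ℝ => Real.exp (c * x)) atTop (𝓝 0) :=
  Real.tendsto_exp_atBot.comp (tendsto_id.const_mul_atTop_of_neg hc)

theorem tendsto_vanillaRescaledModeFactor_one {σ t : ℝ} (hσ : 0 < σ) (h : 1 / σ < t) :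
    Tendsto (fun δ => vanillaRescaledModeFactor σ δ t) atTop (𝓝 1) := by
  rw [div_lt_iff₀' hσ] at h
  simp only [vanillaRescaledModeFactor_eq]
  have h₁ := (tendsto_exp_const_mul_atTop_of_neg (c := 2 * (1 - σ * t)) (by linarith)).const_mul σ
  have h₂ := tendsto_exp_const_mul_atTop_of_neg (c := -(2 * (σ * t))) (by linarith)
  simpa using ((h₁.const_add 1).sub h₂).inv₀ (by simp)

/-- Vanilla learning times: under vanilla ERM in the
vanishing-initialization limit, a mode with singular value `σ` is learned at time
`T = 1/σ` (the rescaled mode factor tends to `0` before `T` and to `1` after `T`).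
Hence, with the SEL singular values `σ ∈ {√R, √((R+1)/2), 1}`, the maj-maj features
are learned at time `1/√R`, the maj-min feature at time `√(2/(R+1))`, and the min-min
features at time `1`; and for every `R > 1` these times are strictly ordered:
`1/√R < √(2/(R+1)) < 1`. -/
theorem vanilla_learning_times (R : ℝ) (hR : 1 < R) :
    (∀ σ : ℝ, (σ = Real.sqrt R ∨ σ = Real.sqrt ((R + 1) / 2) ∨ σ = 1) →
      (∀ t : ℝ, 0 ≤ t → t < 1 / σ →
        Tendsto (fun δ => vanillaRescaledModeFactor σ δ t) atTop (nhds 0)) ∧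
      (∀ t : ℝ, 1 / σ < t →
        Tendsto (fun δ => vanillaRescaledModeFactor σ δ t) atTop (nhds 1))) ∧
    1 / Real.sqrt ((R + 1) / 2) = Real.sqrt (2 / (R + 1)) ∧
    1 / Real.sqrt R < Real.sqrt (2 / (R + 1)) ∧
    Real.sqrt (2 / (R + 1)) < 1 := by
  have hR0 : 0 < R := one_pos.trans hR
  refine ⟨fun σ hσ => ?_, ?_, ?_, ?_⟩
  · have hpos : 0 < σ := by
      rcases hσ with rfl | rfl | rfl <;> positivity
    exact ⟨fun t ht => tendsto_vanillaRescaledModeFactor_zero hpos ht,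
      fun t => tendsto_vanillaRescaledModeFactor_one hpos⟩
  · rw [one_div, ← Real.sqrt_inv, inv_div]
  · rw [one_div, ← Real.sqrt_inv]
    refine Real.sqrt_lt_sqrt (by positivity) ?_
    rw [inv_eq_one_div, div_lt_div_iff₀ hR0 (by positivity)]
    linarith
  · rw [Real.sqrt_lt' one_pos, one_pow, div_lt_one (by positivity)]
    linarith

end
end

section
/- Reweighted learning times (Corollary, reweighted part): with effective weights λ_i = √((R+1)/R) for the maj-maj modes, λ_{k/2} = (√R+1)/√(R+1) for the maj-min mode, and λ_i = √(R+1) for the min-min modes, the products λ_i·σ_i equal √(R+1) for every maj-maj and every min-min mode and (√R+1)/√2 for the maj-min mode. Hence in the vanishing-initialization limit the reweighted dynamics learn the maj-maj and min-min features simultaneously at time 1/√(R+1), and the maj-min feature at time √2/(√R+1); moreover 1/√(R+1) ≤ √2/(√R+1) for all R ≥ 1, so the maj-min feature is learned last. -/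
open Real Filter Topology

noncomputable section

theorem tendsto_exp_neg_mul_atTop {c : ℝ} (hc : c < 0) :
    Tendsto (fun δ => Real.exp (c * δ)) atTop (𝓝 0) :=
  Real.tendsto_exp_atBot.comp (tendsto_id.const_mul_atTop_of_neg hc)

theorem tendsto_rescaledModeFactor_zero {σ lam t : ℝ} (hσ : 0 < σ) (hlam : 0 < lam)
    (ht : 0 ≤ t) (h : t < 1 / (σ * lam)) :
    Tendsto (fun δ => rescaledModeFactor σ lam δ t) atTop (𝓝 0) := by
  simp only [rescaledModeFactor_eq]
  refine Tendsto.inv_tendsto_atTop ?_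
  have hc : 0 < 2 * (1 - σ * lam * t) := by
    rw [lt_div_iff₀ (by positivity)] at h
    linarith
  have hexp : Tendsto (fun δ => σ * Real.exp (2 * (1 - σ * lam * t) * δ)) atTop atTop :=
    (Real.tendsto_exp_atTop.comp (tendsto_id.const_mul_atTop hc)).const_mul_atTop hσ
  refine tendsto_atTop_mono' atTop ?_ hexp
  filter_upwards [eventually_ge_atTop 0] with δ hδ
  have hle : Real.exp (-(2 * σ * lam * t) * δ) ≤ 1 := by
    rw [Real.exp_le_one_iff, neg_mul, neg_nonpos]
    positivity
  linarith

theorem tendsto_rescaledModeFactor_one {σ lam t : ℝ} (hσ : 0 < σ) (hlam : 0 < lam)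
    (h : 1 / (σ * lam) < t) :
    Tendsto (fun δ => rescaledModeFactor σ lam δ t) atTop (𝓝 1) := by
  simp only [rescaledModeFactor_eq]
  rw [div_lt_iff₀ (by positivity)] at h
  have h₁ := (tendsto_exp_neg_mul_atTop
    (show 2 * (1 - σ * lam * t) < 0 by linarith)).const_mul σ
  have h₂ := tendsto_exp_neg_mul_atTop (show -(2 * σ * lam * t) < 0 by linarith)
  simpa using ((h₁.const_add 1).sub h₂).inv₀ (by simp)

/-- Reweighted learning times: with effective weights
`λ = √((R+1)/R)` for the maj-maj modes (`σ = √R`), `λ = (√R+1)/√(R+1)` for the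
maj-min mode (`σ = √((R+1)/2)`), and `λ = √(R+1)` for the min-min modes (`σ = 1`),
the products `λ·σ` equal `√(R+1)` for every maj-maj and min-min mode and
`(√R+1)/√2` for the maj-min mode. Hence, in the vanishing-initialization limit
(where a mode with product `λσ` is learned at time `1/(λσ)`: the rescaled factor
tends to `0` before and to `1` after that time), the reweighted dynamics learn the
maj-maj and min-min features simultaneously at time `1/√(R+1)` and the maj-min
feature at time `√2/(√R+1)`; moreover `1/√(R+1) ≤ √2/(√R+1)` for all `R ≥ 1`, so
the maj-min feature is learned last. -/
theorem reweighted_learning_times (R : ℝ) (hR : 1 ≤ R) :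
    Real.sqrt ((R + 1) / R) * Real.sqrt R = Real.sqrt (R + 1) ∧
    (Real.sqrt R + 1) / Real.sqrt (R + 1) * Real.sqrt ((R + 1) / 2)
      = (Real.sqrt R + 1) / Real.sqrt 2 ∧
    Real.sqrt (R + 1) * 1 = Real.sqrt (R + 1) ∧
    (∀ σ lam : ℝ, 0 < σ → 0 < lam →
      (σ = Real.sqrt R ∧ lam = Real.sqrt ((R + 1) / R)) ∨
      (σ = Real.sqrt ((R + 1) / 2) ∧ lam = (Real.sqrt R + 1) / Real.sqrt (R + 1)) ∨
      (σ = 1 ∧ lam = Real.sqrt (R + 1)) →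
      (∀ t : ℝ, 0 ≤ t → t < 1 / (σ * lam) →
        Tendsto (fun δ => rescaledModeFactor σ lam δ t) atTop (nhds 0)) ∧
      (∀ t : ℝ, 1 / (σ * lam) < t →
        Tendsto (fun δ => rescaledModeFactor σ lam δ t) atTop (nhds 1))) ∧
    1 / Real.sqrt (R + 1) = 1 / (Real.sqrt ((R + 1) / R) * Real.sqrt R) ∧
    1 / Real.sqrt (R + 1) = 1 / (Real.sqrt (R + 1) * 1) ∧
    Real.sqrt 2 / (Real.sqrt R + 1)
      = 1 / ((Real.sqrt R + 1) / Real.sqrt (R + 1) * Real.sqrt ((R + 1) / 2)) ∧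
    1 / Real.sqrt (R + 1) ≤ Real.sqrt 2 / (Real.sqrt R + 1) := by
  have hR₀ : 0 < R := by linarith
  have hmaj : √((R + 1) / R) * √R = √(R + 1) := by
    rw [← Real.sqrt_mul (by positivity), div_mul_cancel₀ _ hR₀.ne']
  have hmid : (√R + 1) / √(R + 1) * √((R + 1) / 2) = (√R + 1) / √2 := by
    have : √(R + 1) ≠ 0 := by positivity
    rw [Real.sqrt_div (by positivity)]
    field_simp
  refine ⟨hmaj, hmid, mul_one _, fun σ lam hσ hlam _ =>
    ⟨fun t ht h => tendsto_rescaledModeFactor_zero hσ hlam ht h,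
      fun t h => tendsto_rescaledModeFactor_one hσ hlam h⟩,
    by rw [hmaj], by rw [mul_one], by rw [hmid, one_div_div], ?_⟩
  rw [div_le_div_iff₀ (by positivity) (by positivity), one_mul, ← Real.sqrt_mul (by norm_num)]
  apply Real.le_sqrt_of_sq_le
  nlinarith [Real.sq_sqrt hR₀.le, sq_nonneg (√R - 1)]

end
end

section
/- Effective learning window of reweighted ERM: with learning times T = 1/(σ_i λ_i) taking the two values 1/√(R+1) and √2/(√R+1) for R ≥ 1, the effective learning window ΔT_RW = (T_max − T_min)/T_min equals √2·√(R+1)/(√R+1) − 1, and satisfies ΔT_RW ≤ √2 − 1 for every R ≥ 1 (with ΔT_RW = 0 at R = 1). Hence the reweighted learning window is bounded independently of the imbalance ratio R. -/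
open Real Filter Topology

noncomputable section

theorem sqrt_add_one_le_sqrt_two_mul_sqrt {x : ℝ} (hx : 0 ≤ x) :
    Real.sqrt x + 1 ≤ Real.sqrt 2 * Real.sqrt (x + 1) := by
  rw [← Real.sqrt_mul (by norm_num)]
  apply Real.le_sqrt_of_sq_le
  nlinarith [Real.sq_sqrt hx, sq_nonneg (Real.sqrt x - 1)]

theorem sqrt_add_one_le_sqrt_add_one {x : ℝ} (hx : 0 ≤ x) :
    Real.sqrt (x + 1) ≤ Real.sqrt x + 1 := by
  rw [Real.sqrt_le_left (by positivity)]
  nlinarith [Real.sq_sqrt hx, Real.sqrt_nonneg x]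

/-- Effective learning window of reweighted ERM: with learning
times `T = 1/(σ_i λ_i)` taking the two values `1/√(R+1)` and `√2/(√R+1)` for
`R ≥ 1`, the effective learning window `ΔT_RW = (T_max − T_min)/T_min` equals
`√2·√(R+1)/(√R+1) − 1`, satisfies `ΔT_RW ≤ √2 − 1` for every `R ≥ 1`, and equals
`0` at `R = 1`. Hence the reweighted learning window is bounded independently of
the imbalance ratio `R`. -/
theorem reweighted_learning_window (R : ℝ) (hR : 1 ≤ R) :
    (max (1 / Real.sqrt (R + 1)) (Real.sqrt 2 / (Real.sqrt R + 1))
        - min (1 / Real.sqrt (R + 1)) (Real.sqrt 2 / (Real.sqrt R + 1)))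
      / min (1 / Real.sqrt (R + 1)) (Real.sqrt 2 / (Real.sqrt R + 1))
      = Real.sqrt 2 * Real.sqrt (R + 1) / (Real.sqrt R + 1) - 1 ∧
    Real.sqrt 2 * Real.sqrt (R + 1) / (Real.sqrt R + 1) - 1 ≤ Real.sqrt 2 - 1 ∧
    (R = 1 → Real.sqrt 2 * Real.sqrt (R + 1) / (Real.sqrt R + 1) - 1 = 0) := by
  have hR0 : 0 ≤ R := zero_le_one.trans hR
  have ha : 0 < Real.sqrt (R + 1) := Real.sqrt_pos.mpr (by linarith)
  have hb : 0 < Real.sqrt R + 1 := by positivity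
  have hle : 1 / Real.sqrt (R + 1) ≤ Real.sqrt 2 / (Real.sqrt R + 1) := by
    rw [div_le_div_iff₀ ha hb, one_mul]
    exact sqrt_add_one_le_sqrt_two_mul_sqrt hR0
  refine ⟨?_, ?_, ?_⟩
  · rw [max_eq_right hle, min_eq_left hle]
    field_simp
  · gcongr
    rw [div_le_iff₀ hb]
    gcongr
    exact sqrt_add_one_le_sqrt_add_one hR0
  · rintro rfl
    norm_num

end
end
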